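/- For every gauge field σ on 𝒢, the total mass of the random-walk loop measure carried by loops of holonomy −1 equals half the logarithm of the ratio of Green determinants: Σ_{n≥2} (1/n) Σ_℘ ∏_{i=1}^n C(x_{i−1},x_i)/W(x_{i−1}) = (1/2)·log( det((G(x,y))_{x,y∈V_int}) / det((G_σ(x,y))_{x,y∈V_int}) ), where the inner sum is over all closed walks ℘=(x_0,x_1,…,x_n=x_0) with consecutive vertices adjacent, all x_i∈V_int, and hol^σ(℘)=∏_{i=1}^n σ(x_{i−1},x_i)=−1; in particular this series converges. Equivalently, det G_σ / det G = exp(−2·μ^loop({loops with holonomy −1})). -/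

import Mathlib

open scoped Classical

/-- The `int × int` matrix of `−Δ_{H,σ}` with zero boundary conditions on `intᶜ`:
diagonal entries `W(x) = Σ_{z∼x} C(x,z)`, off-diagonal entries `−σ(x,y)C(x,y)`
for adjacent `x,y ∈ int`, and `0` otherwise. -/
noncomputable def minusTwistedLapMatrix {α : Type*} [Fintype α] (H : SimpleGraph α)
    (C σ : α → α → ℝ) (int : Finset α) : Matrix int int ℝ :=
  Matrix.of fun x y : int =>
    if (x : α) = (y : α) then ∑ z : α, (if H.Adj (x : α) z then C (x : α) z else 0)
    else if H.Adj (x : α) (y : α) then -(σ (x : α) (y : α) * C (x : α) (y : α)) else 0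

/-- The `σ`-twisted Green's function with zero boundary conditions: the inverse of the
interior matrix of `−Δ_{H,σ}`. -/
noncomputable def twistedGreen {α : Type*} [Fintype α] (H : SimpleGraph α)
    (C σ : α → α → ℝ) (int : Finset α) : Matrix int int ℝ :=
  (minusTwistedLapMatrix H C σ int)⁻¹

/-- The holonomy of a gauge field `σ` along a walk. -/
noncomputable def hol {V : Type*} {G : SimpleGraph V} (σ : V → V → ℝ)
    {x y : V} (w : G.Walk x y) : ℝ :=
  (w.darts.map fun d => σ d.toProd.1 d.toProd.2).prod

/-- The total `μ^loop`-mass of rooted closed walks of length `n + 2` staying in the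
interior and having holonomy `−1`: `(1/n) Σ_℘ ∏_i C(x_{i−1},x_i)/W(x_{i−1})`. -/
noncomputable def negHolLoopMass {V : Type*} [Fintype V] [DecidableEq V]
    (G : SimpleGraph V) [DecidableRel G.Adj] (C σ : V → V → ℝ) (Vi : Finset V)
    (n : ℕ) : ℝ :=
  ∑ x : V, (1 / ((n : ℝ) + 2)) *
    ∑ w : {w : G.Walk x x // w.length = n + 2},
      if (∀ v ∈ (w : G.Walk x x).support, v ∈ Vi) ∧ hol σ (w : G.Walk x x) = -1 then
        ((w : G.Walk x x).darts.map fun d =>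
          C d.toProd.1 d.toProd.2 /
            ∑ z : V, (if G.Adj d.toProd.1 z then C d.toProd.1 z else 0)).prod
      else 0

lemma aux_walk_pow {V : Type*} [Fintype V] [DecidableEq V]
    (G : SimpleGraph V) [DecidableRel G.Adj] (f : V → V → ℝ) (Vi : Finset V) (n : ℕ) (x y : Vi) :
    ∑ w ∈ G.finsetWalkLength n (x : V) (y : V),
      (if (∀ v ∈ w.support, v ∈ Vi) then
        (w.darts.map fun d => f d.toProd.1 d.toProd.2).prod else 0)
    = ((Matrix.of fun a b : Vi => if G.Adj (a : V) (b : V) then f a b else 0) ^ n :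
        Matrix Vi Vi ℝ) x y := by
  induction n generalizing x with
  | zero =>
    obtain ⟨x, hx⟩ := x
    obtain ⟨y, hy⟩ := y
    by_cases h : x = y
    · subst h
      simp [SimpleGraph.finsetWalkLength, hx]
    · simp [SimpleGraph.finsetWalkLength, h, Matrix.one_apply]
  | succ n ih =>
    rw [pow_succ', Matrix.mul_apply]
    simp only [SimpleGraph.finsetWalkLength]
    rw [Finset.sum_biUnion]
    · have h1 : ∀ z : G.neighborSet (x : V),
          ∑ w ∈ (G.finsetWalkLength n (z : V) (y : V)).map
            ⟨fun p => SimpleGraph.Walk.cons z.property p,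
              fun _ _ h => eq_of_heq (SimpleGraph.Walk.cons.inj h).2⟩,
          (if (∀ v ∈ w.support, v ∈ Vi) then
            (w.darts.map fun d => f d.toProd.1 d.toProd.2).prod else 0)
          = (fun z : V => if hz : z ∈ Vi then f x z *
              ((Matrix.of fun a b : Vi => if G.Adj (a : V) (b : V) then f a b else 0) ^ n :
              Matrix Vi Vi ℝ) ⟨z, hz⟩ y else 0) z := by
        intro z
        rw [Finset.sum_map]
        dsimp only [Function.Embedding.coeFn_mk]
        split_ifs with hz
        · rw [← ih ⟨z, hz⟩, Finset.mul_sum]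
          refine Finset.sum_congr rfl fun w _ => ?_
          have hadj : G.Adj (x : V) (z : V) := z.2
          change (if (∀ v ∈ (SimpleGraph.Walk.cons hadj w).support, v ∈ Vi) then
            ((SimpleGraph.Walk.cons hadj w).darts.map
              fun d => f d.toProd.1 d.toProd.2).prod else 0) = _
          simp
        · refine Finset.sum_eq_zero fun w _ => ?_
          rw [if_neg]
          intro h
          have hadj : G.Adj (x : V) (z : V) := z.2
          have h' : ∀ v ∈ (SimpleGraph.Walk.cons hadj w).support, v ∈ Vi := h
          exact hz (h' _ (by simp))
      rw [Finset.sum_congr rfl (fun z _ => h1 z)]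
      refine (Finset.sum_subtype (p := fun z => z ∈ G.neighborSet (x : V))
        (Finset.univ.filter fun z => G.Adj (x : V) z) (by simp)
        (fun z : V => if hz : z ∈ Vi then f x z *
              ((Matrix.of fun a b : Vi => if G.Adj (a : V) (b : V) then f a b else 0) ^ n :
              Matrix Vi Vi ℝ) ⟨z, hz⟩ y else 0)).symm.trans ?_
      rw [Finset.sum_filter]
      symm
      have h2 := Finset.sum_coe_sort Vi (fun z : V => if G.Adj (x : V) z then
        (if hz : z ∈ Vi then f x z *
              ((Matrix.of fun a b : Vi => if G.Adj (a : V) (b : V) then f a b else 0) ^ n :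
              Matrix Vi Vi ℝ) ⟨z, hz⟩ y else 0) else 0)
      rw [← Finset.sum_subset (Finset.subset_univ Vi)]
      · rw [← h2]
        refine Finset.sum_congr rfl fun z _ => ?_
        simp
      · intro z _ hz
        simp [hz]
    · intro z _ z' _ hzz
      rw [Function.onFun, Finset.disjoint_left]
      intro w hw hw'
      simp only [Finset.mem_map, Function.Embedding.coeFn_mk] at hw hw'
      obtain ⟨p, _, rfl⟩ := hw
      obtain ⟨q, _, hq⟩ := hw'
      exact hzz (Subtype.ext (SimpleGraph.Walk.cons.inj hq).1.symm)

lemma aux_hermitian {n : Type*} [Fintype n] [DecidableEq n] (S : Matrix n n ℝ)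
    (hS : S.IsHermitian) (h0 : S.trace = 0)
    (hev : ∀ (l : ℝ) (v : n → ℝ), v ≠ 0 → S.mulVec v = l • v → |l| < 1) :
    0 < (1 - S).det ∧
      HasSum (fun k : ℕ => (S ^ (k + 2)).trace / ((k : ℝ) + 2)) (-Real.log (1 - S).det) := by
  have hl : ∀ i, |hS.eigenvalues i| < 1 := fun i =>
    hev _ _ (by
      have := hS.eigenvectorBasis.orthonormal.ne_zero i
      intro h
      exact this (by ext j; exact congrFun h j)) (hS.mulVec_eigenvectorBasis i)
  have hdet : (1 - S).det = ∏ i, (1 - hS.eigenvalues i) := by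
    have h := Matrix.eval_charpoly S 1
    rw [hS.charpoly_eq, Polynomial.eval_prod] at h
    simpa using h.symm
  have htr : ∀ k, (S ^ k).trace = ∑ i, hS.eigenvalues i ^ k := by
    intro k
    conv_lhs => rw [hS.spectral_theorem, ← map_pow, Unitary.conjStarAlgAut_apply,
      Matrix.trace_mul_comm, ← mul_assoc]
    simp [Matrix.diagonal_pow, Matrix.trace]
  have hpos : ∀ i, 0 < 1 - hS.eigenvalues i := fun i => by
    have := (abs_lt.1 (hl i)).2
    linarith
  refine ⟨by rw [hdet]; exact Finset.prod_pos fun i _ => hpos i, ?_⟩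
  have h1 : HasSum (fun k : ℕ => (S ^ (k + 1)).trace / ((k : ℝ) + 1)) (-Real.log (1 - S).det) := by
    rw [hdet, Real.log_prod (fun i _ => (hpos i).ne'), ← Finset.sum_neg_distrib]
    simp_rw [htr, Finset.sum_div]
    exact hasSum_sum fun i _ => Real.hasSum_pow_div_log_of_abs_lt_one (hl i)
  have h2 := (hasSum_nat_add_iff' 1).2 h1
  simp only [Finset.range_one, Finset.sum_singleton, zero_add, pow_one, h0, zero_div,
    sub_zero] at h2
  have h3 : (fun k : ℕ => (S ^ (k + 2)).trace / ((k : ℝ) + 2)) =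
      fun k : ℕ => (S ^ (k + 1 + 1)).trace / (((k + 1 : ℕ) : ℝ) + 1) := by
    funext k
    rw [show ((k + 1 : ℕ) : ℝ) + 1 = (k : ℝ) + 2 by push_cast; ring]
  rw [h3]
  exact h2

lemma aux_maxprinciple {V : Type*} [Fintype V] [DecidableEq V]
    (G : SimpleGraph V) [DecidableRel G.Adj] (hconn : G.Connected)
    (Vi : Finset V) (hVb : (Viᶜ : Finset V).Nonempty)
    (C τ : V → V → ℝ) (hCpos : ∀ x y, G.Adj x y → 0 < C x y)
    (hτpm : ∀ x y, G.Adj x y → τ x y = 1 ∨ τ x y = -1) (l : ℝ) (u : V → ℝ) (hu : u ≠ 0)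
    (hout : ∀ x, x ∉ Vi → u x = 0)
    (heq : ∀ x, x ∈ Vi → l * u x * (∑ z : V, (if G.Adj x z then C x z else 0)) =
      ∑ z : V, (if G.Adj x z then τ x z * C x z * u z else 0)) : |l| < 1 := by
  by_contra hl
  push Not at hl
  obtain ⟨b, hb⟩ := hVb
  obtain ⟨x0, -, hx0⟩ := Finset.exists_max_image Finset.univ (fun x => |u x|) ⟨b, Finset.mem_univ b⟩
  have hm : 0 < |u x0| := by
    by_contra h
    apply hu
    funext y
    have := hx0 y (Finset.mem_univ y)
    have h3 := abs_nonneg (u y)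
    exact abs_eq_zero.1 (by linarith)
  have step : ∀ x y, |u x| = |u x0| → G.Adj x y → |u y| = |u x0| := by
    intro x y hx hxy
    have hxV : x ∈ Vi := by
      by_contra h
      rw [hout x h] at hx
      simp at hx
      rw [← hx] at hm
      simp at hm
    have h1 := congrArg abs (heq x hxV)
    have h2 : |∑ z : V, (if G.Adj x z then τ x z * C x z * u z else 0)| ≤
        ∑ z : V, (if G.Adj x z then C x z * |u z| else 0) := by
      refine (Finset.abs_sum_le_sum_abs _ _).trans (Finset.sum_le_sum fun z _ => ?_)
      split_ifs with h
      · rw [abs_mul, abs_mul, abs_of_pos (hCpos x z h)]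
        rcases hτpm x z h with h | h <;> simp [h]
      · simp
    have hW : 0 ≤ ∑ z : V, (if G.Adj x z then C x z else 0) :=
      Finset.sum_nonneg fun z _ => by
        split_ifs with h
        · exact (hCpos x z h).le
        · exact le_rfl
    rw [← h1, abs_mul, abs_mul, hx, abs_of_nonneg hW] at h2
    have h4 : |u x0| * (∑ z : V, (if G.Adj x z then C x z else 0)) ≤
        ∑ z : V, (if G.Adj x z then C x z * |u z| else 0) := by
      refine le_trans ?_ h2
      rw [mul_assoc]
      exact le_mul_of_one_le_left (mul_nonneg hm.le hW) hl
    by_contra hne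
    have hlt : |u y| < |u x0| := lt_of_le_of_ne (hx0 y (Finset.mem_univ y)) hne
    have h5 : ∑ z : V, (if G.Adj x z then C x z * |u z| else 0) <
        ∑ z : V, |u x0| * (if G.Adj x z then C x z else 0) := by
      refine Finset.sum_lt_sum (fun z _ => ?_) ⟨y, Finset.mem_univ y, ?_⟩
      · split_ifs with h
        · rw [mul_comm]
          exact mul_le_mul_of_nonneg_right (hx0 z (Finset.mem_univ z)) (hCpos x z h).le
        · simp
      · rw [if_pos hxy, if_pos hxy, mul_comm]
        exact mul_lt_mul_of_pos_right hlt (hCpos x y hxy)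
    rw [← Finset.mul_sum] at h5
    linarith
  have hall : ∀ x y (w : G.Walk x y), |u x| = |u x0| → |u y| = |u x0| := by
    intro x y w
    induction w with
    | nil => exact id
    | cons h p ih => exact fun hx => ih (step _ _ hx h)
  obtain ⟨w⟩ := hconn.preconnected x0 b
  have := hall _ _ w rfl
  rw [hout b (by simpa using hb)] at this
  simp at this
  rw [← this] at hm
  simp at hm

lemma aux_key {V : Type*} [Fintype V] [DecidableEq V]
    (G : SimpleGraph V) [DecidableRel G.Adj] (hconn : G.Connected)
    (Vi : Finset V) (hVb : (Viᶜ : Finset V).Nonempty)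
    (C τ : V → V → ℝ) (hCsym : ∀ x y, C x y = C y x)
    (hCpos : ∀ x y, G.Adj x y → 0 < C x y)
    (hτsym : ∀ x y, τ x y = τ y x)
    (hτpm : ∀ x y, G.Adj x y → τ x y = 1 ∨ τ x y = -1)
    (W : V → ℝ) (hWd : W = fun x => ∑ z : V, (if G.Adj x z then C x z else 0))
    (hW : ∀ x ∈ Vi, 0 < W x) :
    0 < (minusTwistedLapMatrix G C τ Vi).det ∧
    HasSum (fun k : ℕ => (((Matrix.of fun a b : Vi => if G.Adj (a : V) (b : V) then
        τ a b * (C a b / W a) else 0) ^ (k + 2) : Matrix Vi Vi ℝ)).trace / ((k : ℝ) + 2))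
      (Real.log (∏ x : Vi, W x) - Real.log (minusTwistedLapMatrix G C τ Vi).det) := by
  set P : Matrix Vi Vi ℝ := Matrix.of fun a b : Vi => if G.Adj (a : V) (b : V) then
        τ a b * (C a b / W a) else 0 with hP
  set E : Matrix Vi Vi ℝ := Matrix.diagonal fun a => √(W a) with hE
  set F : Matrix Vi Vi ℝ := Matrix.diagonal fun a => (√(W a))⁻¹ with hF
  have hs : ∀ a : Vi, √(W a) ≠ 0 := fun a => (Real.sqrt_pos.2 (hW a a.2)).ne'
  have hEF : E * F = 1 := by
    rw [hE, hF, Matrix.diagonal_mul_diagonal]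
    simp [hs]
  have hFE : F * E = 1 := by
    rw [hE, hF, Matrix.diagonal_mul_diagonal]
    simp [hs]
  set S : Matrix Vi Vi ℝ := E * P * F with hSd
  have hss : ∀ a : Vi, √(W a) * √(W a) = W a := fun a => Real.mul_self_sqrt (hW a a.2).le
  have hSapp : ∀ a b : Vi, S a b = if G.Adj (a : V) (b : V) then
      τ a b * C a b * (√(W a))⁻¹ * (√(W b))⁻¹ else 0 := by
    intro a b
    rw [hSd, hF, hE, Matrix.mul_diagonal, Matrix.diagonal_mul, hP, Matrix.of_apply]
    split_ifs
    · have := hs a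
      nth_rewrite 2 [← hss a]
      field_simp
    · simp
  have hSh : S.IsHermitian := by
    ext a b
    rw [Matrix.conjTranspose_apply, hSapp, hSapp, star_trivial, hCsym b a, hτsym b a]
    simp only [G.adj_comm b a]
    split_ifs
    · ring
    · rfl
  have htr0 : S.trace = 0 := by
    simp [Matrix.trace, hSapp]
  have hpow : ∀ k, S ^ k = E * P ^ k * F := by
    intro k
    induction k with
    | zero => simp [hEF]
    | succ k ih =>
      rw [pow_succ, ih, hSd, pow_succ]
      calc E * P ^ k * F * (E * P * F) = E * P ^ k * (F * E) * P * F := by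
            simp only [mul_assoc]
        _ = _ := by rw [hFE]; simp only [mul_assoc, one_mul, mul_one]
  have htr : ∀ k, (S ^ k).trace = (P ^ k).trace := by
    intro k
    rw [hpow, Matrix.trace_mul_comm, ← mul_assoc, hFE, one_mul]
  have hdet : (minusTwistedLapMatrix G C τ Vi).det = (∏ x : Vi, W x) * (1 - S).det := by
    have hM : minusTwistedLapMatrix G C τ Vi = E * (1 - S) * E := by
      ext a b
      rw [hE, Matrix.mul_diagonal, Matrix.diagonal_mul, Matrix.sub_apply, hSapp,
        minusTwistedLapMatrix, Matrix.of_apply, Matrix.one_apply]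
      by_cases hab : a = b
      · subst hab
        have h := hss a
        have hWa : W a = ∑ z : V, (if G.Adj (a : V) z then C a z else 0) := by rw [hWd]
        simp only [if_true, SimpleGraph.irrefl, if_false, sub_zero, mul_one]
        rw [h, hWa]
        congr!
      · have hab' : (a : V) ≠ b := fun h => hab (Subtype.ext h)
        simp only [hab, hab', if_false]
        have h1 := hs a
        have h2 := hs b
        split_ifs
        · field_simp
          ring
        · simp
    have hprod : (∏ x : Vi, W x) = E.det * E.det := by
      rw [hE, Matrix.det_diagonal, ← Finset.prod_mul_distrib]
      exact Finset.prod_congr rfl fun a _ => (hss a).symm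
    rw [hM, Matrix.det_mul, Matrix.det_mul, hprod]
    ring
  have hev : ∀ (l : ℝ) (v : Vi → ℝ), v ≠ 0 → S.mulVec v = l • v → |l| < 1 := by
    intro l v hv hSv
    refine aux_maxprinciple G hconn Vi hVb C τ hCpos hτpm l
      (fun x => if hx : x ∈ Vi then v ⟨x, hx⟩ * (√(W x))⁻¹ else 0) ?_ ?_ ?_
    · intro h
      apply hv
      funext a
      have := congrFun h a
      simpa [hs a] using this
    · intro x hx
      simp [hx]
    · intro x hx
      have h := congrFun hSv ⟨x, hx⟩
      rw [Matrix.mulVec, dotProduct] at h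
      simp only [hSapp, Pi.smul_apply, smul_eq_mul] at h
      have hWx : W x = ∑ z : V, (if G.Adj x z then C x z else 0) := by rw [hWd]
      rw [← hWx, dif_pos hx, ← Finset.sum_subset (Finset.subset_univ Vi)]
      · rw [← Finset.sum_coe_sort Vi]
        have h1 := hs ⟨x, hx⟩
        have h2 := hss ⟨x, hx⟩
        simp only at h1 h2
        calc _ = √(W x) * (l * v ⟨x, hx⟩) := by
              rw [← h2]
              field_simp
              rw [Real.sqrt_sq (Real.sqrt_nonneg _)]
          _ = _ := by
              rw [← h, Finset.mul_sum]
              refine Finset.sum_congr rfl fun z _ => ?_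
              simp only [Subtype.coe_eta, Finset.coe_mem, dif_pos]
              split_ifs
              · field_simp
              · simp
      · intro z _ hz
        simp [hz]
  obtain ⟨hp, hsum⟩ := aux_hermitian S hSh htr0 hev
  have hWp : 0 < ∏ x : Vi, W x := Finset.prod_pos fun a _ => hW a a.2
  refine ⟨by rw [hdet]; positivity, ?_⟩
  rw [hdet, Real.log_mul hWp.ne' hp.ne', sub_add_cancel_left]
  simpa only [htr] using hsum

lemma aux_green {V : Type*} [Fintype V] [DecidableEq V] (G : SimpleGraph V)
    (C τ : V → V → ℝ) (Vi : Finset V) :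
    (twistedGreen G C τ Vi).det = ((minusTwistedLapMatrix G C τ Vi).det)⁻¹ := by
  rw [← Ring.inverse_eq_inv', ← Matrix.det_nonsing_inv, twistedGreen]
  congr!

lemma aux_mass {V : Type*} [Fintype V] [DecidableEq V]
    (G : SimpleGraph V) [DecidableRel G.Adj] (Vi : Finset V)
    (C σ : V → V → ℝ)
    (hσpm : ∀ x y, G.Adj x y → σ x y = 1 ∨ σ x y = -1)
    (W : V → ℝ) (hWd : W = fun x => ∑ z : V, (if G.Adj x z then C x z else 0)) (n : ℕ) :
    negHolLoopMass G C σ Vi n = (1 / 2) *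
      ((((Matrix.of fun a b : Vi => if G.Adj (a : V) (b : V) then
        (fun _ _ => (1 : ℝ)) (a : V) (b : V) * (C a b / W a) else 0) ^ (n + 2) :
          Matrix Vi Vi ℝ)).trace / ((n : ℝ) + 2) -
      (((Matrix.of fun a b : Vi => if G.Adj (a : V) (b : V) then
        σ a b * (C a b / W a) else 0) ^ (n + 2) : Matrix Vi Vi ℝ)).trace / ((n : ℝ) + 2)) := by
  have hhol : ∀ (x y : V) (w : G.Walk x y), hol σ w = 1 ∨ hol σ w = -1 := by
    intro x y w
    induction w with
    | nil => left; simp [hol]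
    | @cons a b c h p ih =>
      have : hol σ (SimpleGraph.Walk.cons h p) = σ a b * hol σ p := by
        simp only [hol, SimpleGraph.Walk.darts_cons, List.map_cons, List.prod_cons]
      rw [this]
      rcases hσpm _ _ h with h1 | h1 <;> rcases ih with h2 | h2 <;> simp [h1, h2]
  have hterm : ∀ (x y : V) (w : G.Walk x y),
      (if (∀ v ∈ w.support, v ∈ Vi) ∧ hol σ w = -1 then
        (w.darts.map fun d => C d.toProd.1 d.toProd.2 / W d.toProd.1).prod else 0)
      = (1 / 2) * ((if (∀ v ∈ w.support, v ∈ Vi) then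
        (w.darts.map fun d => (fun a b => (fun _ _ => (1 : ℝ)) a b * (C a b / W a))
          d.toProd.1 d.toProd.2).prod else 0) -
        (if (∀ v ∈ w.support, v ∈ Vi) then
        (w.darts.map fun d => (fun a b => σ a b * (C a b / W a))
          d.toProd.1 d.toProd.2).prod else 0)) := by
    intro x y w
    have h1 : (w.darts.map fun d => (fun a b => σ a b * (C a b / W a))
          d.toProd.1 d.toProd.2).prod = hol σ w *
          (w.darts.map fun d => C d.toProd.1 d.toProd.2 / W d.toProd.1).prod := by
      simp only [hol, List.prod_map_mul]
    rw [h1]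
    by_cases hs : ∀ v ∈ w.support, v ∈ Vi
    · rcases hhol x y w with h | h
      · rw [h, if_neg (by norm_num), if_pos hs, if_pos hs]
        simp
      · rw [h, if_pos ⟨hs, rfl⟩, if_pos hs, if_pos hs]
        simp
        ring
    · rw [if_neg (fun h => hs h.1), if_neg hs, if_neg hs]
      simp
  have hin : ∀ x : V, (∑ w : {w : G.Walk x x // w.length = n + 2},
      if (∀ v ∈ (w : G.Walk x x).support, v ∈ Vi) ∧ hol σ (w : G.Walk x x) = -1 then
        ((w : G.Walk x x).darts.map fun d =>
          C d.toProd.1 d.toProd.2 / W d.toProd.1).prod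
      else 0) = ∑ w ∈ G.finsetWalkLength (n + 2) x x,
      if (∀ v ∈ w.support, v ∈ Vi) ∧ hol σ w = -1 then
        (w.darts.map fun d => C d.toProd.1 d.toProd.2 / W d.toProd.1).prod else 0 := by
    intro x
    exact (Finset.sum_subtype (G.finsetWalkLength (n + 2) x x)
      (fun w => SimpleGraph.mem_finsetWalkLength_iff) (fun w : G.Walk x x =>
      if (∀ v ∈ w.support, v ∈ Vi) ∧ hol σ w = -1 then
        (w.darts.map fun d => C d.toProd.1 d.toProd.2 / W d.toProd.1).prod else 0)).symm
  have hmass : negHolLoopMass G C σ Vi n = ∑ x : V, (1 / ((n : ℝ) + 2)) *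
      ∑ w ∈ G.finsetWalkLength (n + 2) x x,
      if (∀ v ∈ w.support, v ∈ Vi) ∧ hol σ w = -1 then
        (w.darts.map fun d => C d.toProd.1 d.toProd.2 / W d.toProd.1).prod else 0 := by
    simp only [← hin]
    rw [hWd]
    rfl
  rw [hmass, ← Finset.sum_subset (Finset.subset_univ Vi)]
  · rw [← Finset.sum_coe_sort Vi, Matrix.trace, Matrix.trace, ← sub_div, ← Finset.sum_sub_distrib,
      Finset.sum_div, Finset.mul_sum]
    refine Finset.sum_congr rfl fun x _ => ?_
    rw [Matrix.diag_apply, Matrix.diag_apply]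
    have e1 := aux_walk_pow G (fun a b => (fun _ _ => (1 : ℝ)) a b * (C a b / W a)) Vi (n + 2) x x
    have e2 := aux_walk_pow G (fun a b => σ a b * (C a b / W a)) Vi (n + 2) x x
    rw [← e1, ← e2, Finset.sum_congr rfl (fun w _ => hterm _ _ w), ← Finset.mul_sum,
      Finset.sum_sub_distrib]
    ring
  · intro x _ hx
    rw [Finset.sum_eq_zero, mul_zero]
    intro w _
    rw [if_neg]
    intro h
    exact hx (h.1 x (by simp))

/-- The total mass of the loop measure carried by loops of holonomy `−1` equals
`(1/2)·log(det G / det G_σ)`; in particular the series converges. Equivalently,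
`det G_σ / det G = exp(−2·μ^loop({loops with holonomy −1}))`. -/
theorem negHolLoopMass_eq_half_log_det_ratio {V : Type*} [Fintype V] [DecidableEq V]
    (G : SimpleGraph V) [DecidableRel G.Adj] (hconn : G.Connected)
    (Vi : Finset V) (hVi : Vi.Nonempty) (hVb : (Viᶜ : Finset V).Nonempty)
    (C σ : V → V → ℝ) (hCsym : ∀ x y, C x y = C y x)
    (hCpos : ∀ x y, G.Adj x y → 0 < C x y)
    (hσsym : ∀ x y, σ x y = σ y x)
    (hσpm : ∀ x y, G.Adj x y → σ x y = 1 ∨ σ x y = -1) :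
    HasSum (negHolLoopMass G C σ Vi)
      ((1 / 2) * Real.log ((twistedGreen G C (fun _ _ => 1) Vi).det /
        (twistedGreen G C σ Vi).det)) ∧
    (twistedGreen G C σ Vi).det / (twistedGreen G C (fun _ _ => 1) Vi).det =
      Real.exp (-2 * ∑' n : ℕ, negHolLoopMass G C σ Vi n) := by
  have hW : ∀ x ∈ Vi, 0 < (fun x => ∑ z : V, (if G.Adj x z then C x z else 0)) x := by
    intro x hx
    obtain ⟨b, hb⟩ := hVb
    have hne : x ≠ b := fun h => by simp [← h, hx] at hb
    obtain ⟨w⟩ := hconn.preconnected x b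
    have hex : ∃ z, G.Adj x z := by
      cases w with
      | nil => exact absurd rfl hne
      | cons h p => exact ⟨_, h⟩
    obtain ⟨z, hz⟩ := hex
    refine Finset.sum_pos' (fun y _ => ?_) ⟨z, Finset.mem_univ z, by simp [hz, hCpos x z hz]⟩
    split_ifs with h
    · exact (hCpos x y h).le
    · exact le_rfl
  obtain ⟨p1, s1⟩ := aux_key G hconn Vi hVb C (fun _ _ => 1) hCsym hCpos (fun _ _ => rfl)
    (fun _ _ _ => Or.inl rfl) _ rfl hW
  obtain ⟨p2, s2⟩ := aux_key G hconn Vi hVb C σ hCsym hCpos hσsym hσpm _ rfl hW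
  have hsum : HasSum (negHolLoopMass G C σ Vi)
      ((1 / 2) * Real.log ((twistedGreen G C (fun _ _ => 1) Vi).det /
        (twistedGreen G C σ Vi).det)) := by
    have h := (s1.sub s2).mul_left (1 / 2)
    rw [aux_green, aux_green, Real.log_div (inv_pos.2 p1).ne' (inv_pos.2 p2).ne', Real.log_inv,
      Real.log_inv]
    have hf : negHolLoopMass G C σ Vi = _ := funext fun n => aux_mass G Vi C σ hσpm _ rfl n
    rw [sub_sub_sub_cancel_left] at h
    rw [hf, neg_sub_neg]
    exact h
  refine ⟨hsum, ?_⟩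
  rw [hsum.tsum_eq, aux_green, aux_green]
  rw [show ∀ t : ℝ, -2 * (1 / 2 * t) = -t from fun t => by ring, Real.exp_neg,
    Real.exp_log (div_pos (inv_pos.2 p1) (inv_pos.2 p2)), inv_div]
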